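/- Let G be a countable discrete amenable group, (V,‖·‖) a complete semi-normed real vector space, π: G → Isom(V) a uniformly bounded representation, and U a subspace of V with U ⊆ cl(L). Then the map Ŝ(v + U) = S(v) + N, where S(v)(F) = Σ_{g∈F} π(g⁻¹)v, is a well-defined, surjective, continuous linear transformation from (V/U, ‖·‖_U) onto ([M_⊕]_N, |||·|||_N), the image of M_⊕ in the quotient M/N with its quotient norm. If U = cl(L), then Ŝ is a linear isomorphism, and if additionally π is isometric then Ŝ is an isometry. -/

import Mathlib

open scoped Pointwise
open Filter

/-- The collection `F(G)` of non-empty finite subsets of `G`. -/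
def FinG (G : Type*) := {F : Finset G // F.Nonempty}

section Defs

variable {G : Type*} [Group G] [DecidableEq G]

/-- `F` is `(K, δ)`-invariant: `|KF Δ F| ≤ δ|F|`. -/
def IsInv (K : Finset G) (δ : ℝ) (F : Finset G) : Prop :=
  ((symmDiff (K * F) F).card : ℝ) ≤ δ * (F.card : ℝ)

/-- `G` is amenable: for every `(K, δ)` there is a `(K, δ)`-invariant nonempty finite set. -/
def AmenableG (G : Type*) [Group G] [DecidableEq G] : Prop :=
  ∀ K : Finset G, K.Nonempty → ∀ δ : ℝ, 0 < δ →
    ∃ F : Finset G, F.Nonempty ∧ IsInv K δ F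

/-- `limsup_{F → G} φ(F) = inf_{(K,δ)} sup {φ(F) : F is (K,δ)-invariant}` (in the extended reals). -/
noncomputable def limsupG (φ : FinG G → ℝ) : EReal :=
  ⨅ (K : {K : Finset G // K.Nonempty}) (δ : {d : ℝ // 0 < d}),
    ⨆ F : {F : FinG G // IsInv K.1 δ.1 F.1}, (φ F.1 : EReal)

/-- `liminf_{F → G} φ(F) = sup_{(K,δ)} inf {φ(F) : F is (K,δ)-invariant}` (in the extended reals). -/
noncomputable def liminfG (φ : FinG G → ℝ) : EReal :=
  ⨆ (K : {K : Finset G // K.Nonempty}) (δ : {d : ℝ // 0 < d}),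
    ⨅ F : {F : FinG G // IsInv K.1 δ.1 F.1}, (φ F.1 : EReal)

/-- `lim_{F → G} φ(F) = L`. -/
def TendstoG (φ : FinG G → ℝ) (L : ℝ) : Prop :=
  ∀ ε : ℝ, 0 < ε → ∃ (K : Finset G) (δ : ℝ), K.Nonempty ∧ 0 < δ ∧
    ∀ F : FinG G, IsInv K δ F.1 → |φ F - L| < ε

/-- A (left) Følner sequence: `|F_n Δ g F_n| / |F_n| → 0` for every `g ∈ G`. -/
def FolnerSeq (F : ℕ → FinG G) : Prop :=
  ∀ g : G, Filter.Tendsto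
    (fun n => ((symmDiff ((F n).1.image (fun h => g * h)) (F n).1).card : ℝ) / ((F n).1.card : ℝ))
    Filter.atTop (nhds (0 : ℝ))

variable {V : Type*} [SeminormedAddCommGroup V] [NormedSpace ℝ V]

/-- The representation `π` is uniformly bounded with constant `C`. -/
def UnifBdd (π : G →* (V ≃L[ℝ] V)) (C : ℝ) : Prop :=
  ∀ (g : G) (v : V), ‖π g v‖ ≤ C * ‖v‖

/-- The representation `π` is isometric (`C_π = 1`). -/
def IsIsometric (π : G →* (V ≃L[ℝ] V)) : Prop :=
  ∀ (g : G) (v : V), ‖π g v‖ = ‖v‖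

/-- The ergodic sum `S_F v = Σ_{g ∈ F} π(g⁻¹) v`. -/
noncomputable def SF (π : G →* (V ≃L[ℝ] V)) (F : Finset G) (v : V) : V :=
  ∑ g ∈ F, π g⁻¹ v

/-- The ergodic average `A_F v = |F|⁻¹ • S_F v`. -/
noncomputable def AF (π : G →* (V ≃L[ℝ] V)) (F : Finset G) (v : V) : V :=
  (F.card : ℝ)⁻¹ • SF π F v

/-- Right translation `g • F = F g⁻¹` on nonempty finite subsets. -/
def rT (g : G) (F : FinG G) : FinG G :=
  ⟨F.1.image (fun h => h * g⁻¹), F.2.image (fun h => h * g⁻¹)⟩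

/-- `G`-equivariance of a set map: `π(g) φ(F) = φ(F g⁻¹)`. -/
def IsEquivariant (π : G →* (V ≃L[ℝ] V)) (φ : FinG G → V) : Prop :=
  ∀ (g : G) (F : FinG G), π g (φ F) = φ (rT g F)

/-- Boundedness of a set map: `sup_F ‖φ(F)‖/|F| < ∞`. -/
def IsBddMap (φ : FinG G → V) : Prop :=
  ∃ C : ℝ, ∀ F : FinG G, ‖φ F‖ ≤ C * (F.1.card : ℝ)

/-- Membership in the space `M` of bounded `G`-equivariant set maps. -/
def MemM (π : G →* (V ≃L[ℝ] V)) (φ : FinG G → V) : Prop :=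
  IsBddMap φ ∧ IsEquivariant π φ

/-- The sup seminorm `|||φ|||_sup = sup_F ‖φ(F)‖/|F|`. -/
noncomputable def supNorm (φ : FinG G → V) : ℝ :=
  ⨆ F : FinG G, ‖φ F‖ / (F.1.card : ℝ)

/-- The asymptotic seminorm `|||φ|||_G = limsup_{F → G} ‖φ(F)‖/|F|` (in the extended reals). -/
noncomputable def normG (φ : FinG G → V) : EReal :=
  limsupG (fun F => ‖φ F‖ / (F.1.card : ℝ))

/-- Union of nonempty finite subsets. -/
def unionF (E F : FinG G) : FinG G :=
  ⟨E.1 ∪ F.1, E.2.inl⟩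

/-- Additive set maps: `φ(E ⊔ F) = φ(E) + φ(F)` for disjoint `E, F`. -/
def IsAdditiveMap (φ : FinG G → V) : Prop :=
  ∀ E F : FinG G, Disjoint E.1 F.1 → φ (unionF E F) = φ E + φ F

/-- The additive set map `S(v)(F) = S_F v`. -/
noncomputable def Smap (π : G →* (V ≃L[ℝ] V)) (v : V) : FinG G → V :=
  fun F => SF π F.1 v

/-- The coboundary subspace `L_W = span{w − π(g)w : w ∈ W, g ∈ G}`. -/
def cobSpan (π : G →* (V ≃L[ℝ] V)) (W : Set V) : Submodule ℝ V :=
  Submodule.span ℝ {x | ∃ w ∈ W, ∃ g : G, x = w - π g w}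

/-- The coboundary subspace `L = L_V`. -/
def cobL (π : G →* (V ≃L[ℝ] V)) : Submodule ℝ V :=
  cobSpan π Set.univ

/-- The quotient seminorm `‖v + U‖_U = inf_{u ∈ U} ‖v + u‖`. -/
noncomputable def qnorm (U : Set V) (v : V) : ℝ :=
  ⨅ u : U, ‖v + u.1‖

/-- `v` is an additive realization of `φ`: `lim_{F→G} ‖φ(F)/|F| − A_F v‖ = 0`. -/
def IsRealization (π : G →* (V ≃L[ℝ] V)) (φ : FinG G → V) (v : V) : Prop :=
  TendstoG (fun F => ‖(F.1.card : ℝ)⁻¹ • φ F - AF π F.1 v‖) 0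

/-- `φ` is asymptotically additive: `inf_{ψ ∈ M_⊕} |||φ − ψ|||_G = 0`. -/
def AsympAdd (π : G →* (V ≃L[ℝ] V)) (φ : FinG G → V) : Prop :=
  (⨅ ψ : {ψ : FinG G → V // MemM π ψ ∧ IsAdditiveMap ψ}, normG (φ - ψ.1)) = (0 : EReal)

/-- `φ` is asymptotically additive relative to `W`. -/
def AsympAddRel (π : G →* (V ≃L[ℝ] V)) (W : Set V) (φ : FinG G → V) : Prop :=
  (⨅ w : W, limsupG (fun F => ‖(F.1.card : ℝ)⁻¹ • φ F - AF π F.1 w.1‖)) = (0 : EReal)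

/-- The quotient norm on `M_⊕ / N_⊕`. -/
noncomputable def qMplusN (π : G →* (V ≃L[ℝ] V)) (ψ : FinG G → V) : ℝ :=
  ⨅ η : {η : FinG G → V // MemM π η ∧ IsAdditiveMap η ∧ normG η = (0 : EReal)},
    supNorm (ψ + η.1)

end Defs

section LimsupG

variable {G : Type*} [Group G] [DecidableEq G]

theorem IsInv.mono {K₁ K₂ F : Finset G} {δ₁ δ₂ : ℝ} (h₁ : 1 ∈ K₁) (hK : K₁ ⊆ K₂) (hδ : δ₂ ≤ δ₁)
    (h : IsInv K₂ δ₂ F) : IsInv K₁ δ₁ F := by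
  unfold IsInv at *
  have hF : ∀ {K : Finset G}, 1 ∈ K → F ⊆ K * F := fun hK x hx =>
    Finset.mem_mul.2 ⟨1, hK, x, hx, one_mul x⟩
  rw [symmDiff_of_ge (hF (hK h₁))] at h
  rw [symmDiff_of_ge (hF h₁)]
  calc (((K₁ * F) \ F).card : ℝ) ≤ ((K₂ * F) \ F).card := by
        exact_mod_cast Finset.card_le_card
          (Finset.sdiff_subset_sdiff (Finset.mul_subset_mul_right hK) le_rfl)
    _ ≤ δ₂ * F.card := h
    _ ≤ δ₁ * F.card := by gcongr

theorem limsupG_le {φ : FinG G → ℝ} {c : ℝ}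
    (h : ∀ ε : ℝ, 0 < ε → ∃ (K : Finset G) (δ : ℝ), K.Nonempty ∧ 0 < δ ∧
      ∀ F : FinG G, IsInv K δ F.1 → φ F ≤ c + ε) : limsupG φ ≤ (c : EReal) := by
  refine EReal.le_of_forall_lt_iff_le.1 fun z hz => ?_
  obtain ⟨K, δ, hK, hδ, hF⟩ := h (z - c) (sub_pos.2 (by exact_mod_cast hz))
  refine iInf₂_le_of_le ⟨K, hK⟩ ⟨δ, hδ⟩ (iSup_le fun F => ?_)
  simpa using hF F.1 F.2

theorem le_limsupG (hG : AmenableG G) {φ : FinG G → ℝ} {c : ℝ} (h : ∀ F, c ≤ φ F) :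
    (c : EReal) ≤ limsupG φ := by
  refine le_iInf₂ fun K δ => ?_
  obtain ⟨F, hF, hF'⟩ := hG K.1 K.2 δ.1 δ.2
  exact le_iSup_of_le ⟨⟨F, hF⟩, hF'⟩ (by exact_mod_cast h _)

end LimsupG

section ErgodicSums

set_option linter.unusedSectionVars false

variable {G : Type*} [Group G] [DecidableEq G]
  {V : Type*} [SeminormedAddCommGroup V] [NormedSpace ℝ V]

theorem FinG.card_pos (F : FinG G) : (0 : ℝ) < F.1.card := by
  exact_mod_cast F.2.card_pos

theorem normG_eq_zero (hG : AmenableG G) {φ : FinG G → V}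
    (h : ∀ ε : ℝ, 0 < ε → ∃ (K : Finset G) (δ : ℝ), K.Nonempty ∧ 0 < δ ∧
      ∀ F : FinG G, IsInv K δ F.1 → ‖φ F‖ ≤ ε * F.1.card) : normG φ = 0 := by
  refine le_antisymm (limsupG_le (c := 0) fun ε hε => ?_)
    (le_limsupG (c := 0) hG fun F => by positivity)
  obtain ⟨K, δ, hK, hδ, hF⟩ := h ε hε
  refine ⟨K, δ, hK, hδ, fun F hFi => ?_⟩
  rw [zero_add, div_le_iff₀ F.card_pos]
  exact hF F hFi

variable {π : G →* (V ≃L[ℝ] V)} {C : ℝ}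

theorem SF_add (F : Finset G) (v w : V) : SF π F (v + w) = SF π F v + SF π F w := by
  simp [SF, Finset.sum_add_distrib]

theorem SF_smul (F : Finset G) (c : ℝ) (v : V) : SF π F (c • v) = c • SF π F v := by
  simp [SF, Finset.smul_sum]

theorem SF_sub (F : Finset G) (v w : V) : SF π F (v - w) = SF π F v - SF π F w := by
  simp [SF, Finset.sum_sub_distrib]

theorem UnifBdd.norm_sum_le (hπ : UnifBdd π C) (F : Finset G) (v : V) :
    ‖SF π F v‖ ≤ C * ‖v‖ * F.card := by
  refine (norm_sum_le_of_le F fun g _ => hπ g⁻¹ v).trans_eq ?_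
  simp [mul_comm]

theorem UnifBdd.mul_norm_nonneg (hπ : UnifBdd π C) (v : V) : 0 ≤ C * ‖v‖ :=
  (norm_nonneg _).trans (hπ 1 v)

theorem norm_SF_coboundary_le (hπ : UnifBdd π C) (g : G) (w : V) {δ : ℝ} {F : Finset G}
    (hF : IsInv {1, g⁻¹} δ F) : ‖SF π F (w - π g w)‖ ≤ 2 * (C * ‖w‖) * (δ * F.card) := by
  set B : Finset G := F.image (fun h => g⁻¹ * h) with hB
  have hcard : B.card = F.card := Finset.card_image_of_injective _ (mul_right_injective _)
  have hB' : SF π F (π g w) = SF π B w := by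
    rw [SF, SF, hB, Finset.sum_image (mul_right_injective g⁻¹).injOn]
    exact Finset.sum_congr rfl fun h _ => by rw [mul_inv_rev, inv_inv, map_mul]; rfl
  have hsum : SF π F (w - π g w) = SF π (F \ B) w - SF π (B \ F) w := by
    rw [SF_sub, hB']
    exact Finset.sum_sdiff_sub_sum_sdiff.symm
  have hBF : ((B \ F).card : ℝ) ≤ δ * F.card := by
    refine le_trans ?_ hF
    exact_mod_cast Finset.card_le_card fun x hx => by
      obtain ⟨hx, hxF⟩ := Finset.mem_sdiff.1 hx
      obtain ⟨h, hh, rfl⟩ := Finset.mem_image.1 hx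
      exact Finset.mem_symmDiff.2 (.inl ⟨Finset.mul_mem_mul (by simp) hh, hxF⟩)
  have hFB : ((F \ B).card : ℝ) ≤ δ * F.card := by
    rwa [Finset.card_sdiff_comm hcard.symm]
  have h₀ := hπ.mul_norm_nonneg w
  calc ‖SF π F (w - π g w)‖ ≤ ‖SF π (F \ B) w‖ + ‖SF π (B \ F) w‖ := by
        rw [hsum]; exact norm_sub_le _ _
    _ ≤ C * ‖w‖ * (F \ B).card + C * ‖w‖ * (B \ F).card :=
        add_le_add (hπ.norm_sum_le _ _) (hπ.norm_sum_le _ _)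
    _ ≤ C * ‖w‖ * (δ * F.card) + C * ‖w‖ * (δ * F.card) := by gcongr
    _ = _ := by ring

/-- The ergodic averages of `v` vanish along sufficiently invariant sets. -/
def HasNullAverages (π : G →* (V ≃L[ℝ] V)) (v : V) : Prop :=
  ∀ ε : ℝ, 0 < ε → ∃ (K : Finset G) (δ : ℝ), 1 ∈ K ∧ 0 < δ ∧
    ∀ F : FinG G, IsInv K δ F.1 → ‖SF π F.1 v‖ ≤ ε * F.1.card

theorem hasNullAverages_of_mem_cobL (hπ : UnifBdd π C) {v : V} (hv : v ∈ cobL π) :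
    HasNullAverages π v := by
  induction hv using Submodule.span_induction with
  | mem x hx =>
    obtain ⟨w, -, g, rfl⟩ := hx
    intro ε hε
    have h₀ := hπ.mul_norm_nonneg w
    refine ⟨{1, g⁻¹}, ε / (2 * (C * ‖w‖) + 1), by simp, by positivity, fun F hF => ?_⟩
    refine (norm_SF_coboundary_le hπ g w hF).trans ?_
    rw [← mul_assoc]
    gcongr
    rw [mul_div_assoc', div_le_iff₀ (by positivity)]
    nlinarith
  | zero => exact fun ε hε => ⟨{1}, 1, by simp, one_pos, fun F _ => by simp [SF]; positivity⟩
  | add x y _ _ hx hy =>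
    intro ε hε
    obtain ⟨K₁, δ₁, hK₁, hδ₁, h₁⟩ := hx (ε / 2) (half_pos hε)
    obtain ⟨K₂, δ₂, hK₂, hδ₂, h₂⟩ := hy (ε / 2) (half_pos hε)
    refine ⟨K₁ ∪ K₂, min δ₁ δ₂, Finset.mem_union_left _ hK₁, lt_min hδ₁ hδ₂, fun F hF => ?_⟩
    have h₁' := h₁ F (hF.mono hK₁ Finset.subset_union_left (min_le_left _ _))
    have h₂' := h₂ F (hF.mono hK₂ Finset.subset_union_right (min_le_right _ _))
    rw [SF_add]
    linarith [norm_add_le (SF π F.1 x) (SF π F.1 y)]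
  | smul c x _ hx =>
    intro ε hε
    obtain ⟨K, δ, hK, hδ, h⟩ := hx (ε / (‖c‖ + 1)) (by positivity)
    refine ⟨K, δ, hK, hδ, fun F hF => ?_⟩
    rw [SF_smul, norm_smul]
    calc ‖c‖ * ‖SF π F.1 x‖ ≤ (‖c‖ + 1) * (ε / (‖c‖ + 1) * F.1.card) := by
          gcongr
          · linarith
          · exact h F hF
      _ = ε * F.1.card := by field_simp

theorem hasNullAverages_of_mem_closure (hπ : UnifBdd π C) {v : V}
    (hv : v ∈ closure (cobL π : Set V)) : HasNullAverages π v := by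
  intro ε hε
  obtain ⟨u, hu, hvu⟩ := Metric.mem_closure_iff.1 hv (ε / (2 * (|C| + 1))) (by positivity)
  obtain ⟨K, δ, hK, hδ, h⟩ := hasNullAverages_of_mem_cobL hπ hu (ε / 2) (half_pos hε)
  refine ⟨K, δ, hK, hδ, fun F hF => ?_⟩
  rw [dist_eq_norm] at hvu
  have hsmall : C * ‖v - u‖ ≤ ε / 2 :=
    calc C * ‖v - u‖ ≤ (|C| + 1) * (ε / (2 * (|C| + 1))) := by
          gcongr
          linarith [le_abs_self C]
      _ = ε / 2 := by field_simp
  calc ‖SF π F.1 v‖ = ‖SF π F.1 (v - u) + SF π F.1 u‖ := by rw [← SF_add, sub_add_cancel]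
    _ ≤ C * ‖v - u‖ * F.1.card + ε / 2 * F.1.card :=
        (norm_add_le _ _).trans (add_le_add (hπ.norm_sum_le _ _) (h F hF))
    _ ≤ ε / 2 * F.1.card + ε / 2 * F.1.card := by gcongr
    _ = ε * F.1.card := by ring

theorem AF_sub_mem_cobL (F : FinG G) (v : V) : AF π F.1 v - v ∈ cobL π := by
  have h : AF π F.1 v - v = (F.1.card : ℝ)⁻¹ • ∑ g ∈ F.1, -(v - π g⁻¹ v) := by
    simp only [neg_sub, Finset.sum_sub_distrib, Finset.sum_const, smul_sub, AF, SF]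
    rw [← Nat.cast_smul_eq_nsmul ℝ, inv_smul_smul₀ F.card_pos.ne']
  rw [h]
  exact Submodule.smul_mem _ _ (Submodule.sum_mem _ fun g _ =>
    Submodule.neg_mem _ (Submodule.subset_span ⟨v, Set.mem_univ v, g⁻¹, rfl⟩))

theorem bddBelow_range_norm_add (U : Set V) (v : V) :
    BddBelow (Set.range fun u : U => ‖v + u.1‖) :=
  ⟨0, by rintro _ ⟨u, rfl⟩; exact norm_nonneg _⟩

theorem qnorm_nonneg (U : Set V) (v : V) : 0 ≤ qnorm U v :=
  Real.iInf_nonneg fun _ => norm_nonneg _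

theorem qnorm_le {U : Set V} {u : V} (hu : u ∈ U) (v : V) : qnorm U v ≤ ‖v + u‖ :=
  ciInf_le (bddBelow_range_norm_add U v) ⟨u, hu⟩

theorem mem_closure_of_qnorm_le_zero {U : Submodule ℝ V} {v : V}
    (h : qnorm (U : Set V) v ≤ 0) : v ∈ closure (U : Set V) := by
  refine Metric.mem_closure_iff.2 fun ε hε => ?_
  obtain ⟨u, hu⟩ := exists_lt_of_ciInf_lt (h.trans_lt hε)
  exact ⟨-u.1, U.neg_mem u.2, by simpa [dist_eq_norm] using hu⟩

theorem qnorm_le_normG_Smap (hG : AmenableG G) {U : Set V} (hU : (cobL π : Set V) ⊆ U) (v : V) :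
    (qnorm U v : EReal) ≤ normG (Smap π v) := by
  refine le_limsupG hG fun F => ?_
  refine (qnorm_le (hU (AF_sub_mem_cobL F v)) v).trans_eq ?_
  rw [add_sub_cancel, AF, norm_smul, norm_inv, Real.norm_natCast, Smap, inv_mul_eq_div]

theorem normG_Smap_le (hπ : UnifBdd π C) {U : Submodule ℝ V}
    (hU : (U : Set V) ⊆ closure (cobL π : Set V)) (v : V) :
    normG (Smap π v) ≤ ((C * qnorm (U : Set V) v : ℝ) : EReal) := by
  refine limsupG_le fun ε hε => ?_
  obtain ⟨u, hu, hvu⟩ : ∃ u ∈ U, C * ‖v + u‖ < C * qnorm (U : Set V) v + ε / 2 := by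
    rcases le_or_gt 0 C with hC | hC
    · have h : (⨅ u : (U : Set V), C * ‖v + u.1‖) < C * qnorm (U : Set V) v + ε / 2 := by
        rw [← Real.mul_iInf_of_nonneg hC, ← qnorm]
        linarith
      have : Nonempty (U : Set V) := ⟨⟨0, U.zero_mem⟩⟩
      obtain ⟨u, hu⟩ := exists_lt_of_ciInf_lt h
      exact ⟨u.1, u.2, hu⟩
    · refine ⟨0, U.zero_mem, ?_⟩
      have h₀ := hπ.mul_norm_nonneg (v + 0)
      have h₁ := norm_nonneg (v + 0)
      have h₂ := qnorm_le U.zero_mem v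
      have h₃ : ‖v + 0‖ = 0 := by nlinarith
      have h₄ : qnorm (U : Set V) v = 0 := le_antisymm (h₂.trans_eq h₃) (qnorm_nonneg _ v)
      rw [h₃, h₄]
      linarith
  obtain ⟨K, δ, hK, hδ, h⟩ := hasNullAverages_of_mem_closure hπ (hU hu) (ε / 2) (half_pos hε)
  refine ⟨K, δ, ⟨1, hK⟩, hδ, fun F hF => ?_⟩
  rw [div_le_iff₀ F.card_pos]
  calc ‖SF π F.1 v‖ = ‖SF π F.1 (v + u) - SF π F.1 u‖ := by rw [← SF_sub, add_sub_cancel_right]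
    _ ≤ C * ‖v + u‖ * F.1.card + ε / 2 * F.1.card :=
        (norm_sub_le _ _).trans (add_le_add (hπ.norm_sum_le _ _) (h F hF))
    _ ≤ (C * qnorm (U : Set V) v + ε / 2) * F.1.card + ε / 2 * F.1.card := by gcongr
    _ = (C * qnorm (U : Set V) v + ε) * F.1.card := by ring

theorem isEquivariant_Smap (v : V) : IsEquivariant π (Smap π v) := by
  intro g F
  simp only [Smap, SF, rT, map_sum]
  rw [Finset.sum_image (mul_left_injective g⁻¹).injOn]
  exact Finset.sum_congr rfl fun h _ => by rw [mul_inv_rev, inv_inv, map_mul]; rfl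

theorem isAdditiveMap_Smap (v : V) : IsAdditiveMap (Smap π v) :=
  fun _ _ h => Finset.sum_union h

theorem memM_Smap (hπ : UnifBdd π C) (v : V) : MemM π (Smap π v) :=
  ⟨⟨C * ‖v‖, fun F => hπ.norm_sum_le F.1 v⟩, isEquivariant_Smap v⟩

/-- An additive equivariant set map is determined by its value at `{1}`. -/
theorem IsAdditiveMap.eq_Smap {ψ : FinG G → V} (hadd : IsAdditiveMap ψ)
    (heq : IsEquivariant π ψ) : ψ = Smap π (ψ ⟨{1}, Finset.singleton_nonempty 1⟩) := by
  have hsing : ∀ g : G, ψ ⟨{g}, Finset.singleton_nonempty g⟩ =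
      π g⁻¹ (ψ ⟨{1}, Finset.singleton_nonempty 1⟩) := by
    refine fun g => Eq.trans (congrArg ψ (Subtype.ext ?_)) (heq g⁻¹ _).symm
    simp [rT]
  funext ⟨F, hF⟩
  induction hF using Finset.Nonempty.cons_induction with
  | singleton a => simpa [Smap, SF] using hsing a
  | cons a s ha hs ih =>
    have h := hadd ⟨{a}, Finset.singleton_nonempty a⟩ ⟨s, hs⟩ (by simpa using ha)
    have h' : unionF ⟨{a}, Finset.singleton_nonempty a⟩ ⟨s, hs⟩ =
        (⟨Finset.cons a s ha, Finset.cons_nonempty ha⟩ : FinG G) :=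
      Subtype.ext (by simp [unionF])
    rw [h', ih, hsing] at h
    exact h.trans (Finset.sum_cons
      (f := fun g => π g⁻¹ (ψ ⟨{1}, Finset.singleton_nonempty 1⟩)) ha).symm

end ErgodicSums

theorem statement16 {G : Type*} [Group G] [DecidableEq G] [Countable G]
    {V : Type*} [SeminormedAddCommGroup V] [NormedSpace ℝ V] [CompleteSpace V]
    (hG : AmenableG G) (π : G →* (V ≃L[ℝ] V)) (C : ℝ) (hπ : UnifBdd π C)
    (U : Submodule ℝ V) (hU : (U : Set V) ⊆ closure (cobL π : Set V)) :
    -- `Ŝ(v + U) = S(v) + N` is well defined: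
    (∀ u ∈ (U : Set V), normG (Smap π u) = (0 : EReal)) ∧
    -- it is linear:
    (∀ v w : V, Smap π (v + w) = Smap π v + Smap π w) ∧
    (∀ (c : ℝ) (v : V), Smap π (c • v) = c • Smap π v) ∧
    -- it maps into `[M_⊕]_N`:
    (∀ v : V, MemM π (Smap π v) ∧ IsAdditiveMap (Smap π v)) ∧
    -- it is continuous (recall `|||φ + N|||_N = |||φ|||_G`):
    (∀ v : V, normG (Smap π v) ≤ ((C * qnorm (U : Set V) v : ℝ) : EReal)) ∧
    -- it is surjective onto `[M_⊕]_N`: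
    (∀ ψ : FinG G → V, MemM π ψ → IsAdditiveMap ψ →
      ∃ v : V, normG (Smap π v - ψ) = (0 : EReal)) ∧
    -- if `U = cl(L)` then `Ŝ` is a linear isomorphism (injective, continuous inverse):
    ((U : Set V) = closure (cobL π : Set V) →
      (∀ v w : V, normG (Smap π v - Smap π w) = (0 : EReal) → v - w ∈ (U : Set V)) ∧
      ∃ C' : ℝ, ∀ v : V,
        ((qnorm (U : Set V) v : ℝ) : EReal) ≤ ((C' : ℝ) : EReal) * normG (Smap π v)) ∧
    -- if additionally `π` is isometric then `Ŝ` is an isometry: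
    ((U : Set V) = closure (cobL π : Set V) → IsIsometric π →
      ∀ v : V, normG (Smap π v) = ((qnorm (U : Set V) v : ℝ) : EReal)) := by
  have hnull : ∀ v ∈ U, normG (Smap π v) = 0 := fun v hv => normG_eq_zero hG fun ε hε => by
    obtain ⟨K, δ, hK, hδ, h⟩ := hasNullAverages_of_mem_closure hπ (hU hv) ε hε
    exact ⟨K, δ, ⟨1, hK⟩, hδ, h⟩
  refine ⟨hnull, fun v w => funext fun F => SF_add F.1 v w,
    fun c v => funext fun F => SF_smul F.1 c v,
    fun v => ⟨memM_Smap hπ v, isAdditiveMap_Smap v⟩, normG_Smap_le hπ hU,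
    fun ψ hψ hadd => ⟨ψ ⟨{1}, Finset.singleton_nonempty 1⟩, ?_⟩,
    fun hUL => ⟨fun v w hvw => ?_, 1, fun v => ?_⟩, fun hUL hiso v => le_antisymm ?_ ?_⟩
  · rw [← hadd.eq_Smap hψ.2, sub_self]
    exact normG_eq_zero hG fun ε hε => ⟨{1}, 1, by simp, one_pos, fun F _ => by
      simp only [Pi.zero_apply, norm_zero]; positivity⟩
  · have hclosed : closure (U : Set V) = U := by rw [hUL, closure_closure]
    have hsub : Smap π v - Smap π w = Smap π (v - w) := funext fun F => (SF_sub F.1 v w).symm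
    rw [← hclosed]
    refine mem_closure_of_qnorm_le_zero ?_
    have h := qnorm_le_normG_Smap hG (subset_closure.trans hUL.ge) (v - w)
    rw [← hsub, hvw] at h
    exact_mod_cast h
  · rw [EReal.coe_one, one_mul]
    exact qnorm_le_normG_Smap hG (subset_closure.trans hUL.ge) v
  · have h₁ : UnifBdd π 1 := fun g v => by rw [one_mul, hiso]
    simpa using normG_Smap_le h₁ hU v
  · exact qnorm_le_normG_Smap hG (subset_closure.trans hUL.ge) v
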